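/- Let n ≥ 3, let 1 ≤ t ≤ n−2, and let a_1, a_2, …, a_n be elements of a group G satisfying the defining relations of A(Δ_n), i.e. BR(a_i, a_{i+1}) for 1 ≤ i ≤ n−1, BR(a_n, a_1), and CM(a_i, a_j) for all other pairs i < j. Then the n conditions tc_t(a_1, a_2, …, a_n) = 1, tc_t(a_2, a_3, …, a_n, a_1) = 1, …, tc_t(a_n, a_1, …, a_{n−1}) = 1 (one for each cyclic rotation of the sequence a_1, …, a_n) are all equivalent. -/

import Mathlib

/- Scaffolding: braid/commuting predicates, ordered products, cycle and twisted
cycle commutators, and the Artin groups of the diagrams `Δ_n`, `Δ_{t,n}`, `D_n`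
(generators numbered `1, …, n` as in the paper, realized on the index type `Fin n`). -/

namespace ArtinPaper

open scoped commutatorElement

/-- `BR u v` : `u` and `v` braid, i.e. `u v u = v u v`. -/
def BR {G : Type*} [Group G] (u v : G) : Prop := u * v * u = v * u * v

/-- `CM u v` : `u` and `v` commute, i.e. `u v = v u`. -/
def CM {G : Type*} [Group G] (u v : G) : Prop := u * v = v * u

/-- `mulIcc y a b = y a * y (a+1) * ⋯ * y b` (equal to `1` when `a > b`). -/
def mulIcc {M : Type*} [Monoid M] (y : ℕ → M) (a b : ℕ) : M :=
  ((List.range (b + 1 - a)).map fun i => y (a + i)).prod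

/-- The cycle commutator
`cc(y₁,…,yₙ) = [y₁, y₂ ⋯ y_{n-1} yₙ y_{n-1}⁻¹ ⋯ y₂⁻¹]`. -/
def cc {G : Type*} [Group G] (y : ℕ → G) (n : ℕ) : G :=
  ⁅y 1, mulIcc y 2 (n - 1) * y n * (mulIcc y 2 (n - 1))⁻¹⁆

/-- The `t`-twisted cycle commutator
`tc_t(y₁,…,yₙ) = [y₁, y₂⁻¹ ⋯ y_{t+1}⁻¹ y_{t+2} ⋯ y_{n-1} yₙ y_{n-1}⁻¹ ⋯ y_{t+2}⁻¹ y_{t+1} ⋯ y₂]`.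
(The twisted cycle commutator `tc(y₁,y₂,y₃,y₄)` is `tc y 4 1`.) -/
def tc {G : Type*} [Group G] (y : ℕ → G) (n t : ℕ) : G :=
  ⁅y 1, mulIcc (fun i => (y i)⁻¹) 2 (t + 1) *
      (mulIcc y (t + 2) (n - 1) * y n * (mulIcc y (t + 2) (n - 1))⁻¹) *
      (mulIcc (fun i => (y i)⁻¹) 2 (t + 1))⁻¹⁆

/-- The `i`-th generator (numbered `1, …, n`) of the free group on `Fin n`. -/
def gen (n i : ℕ) : FreeGroup (Fin n) :=
  if h : 0 < n then FreeGroup.of ⟨(i - 1) % n, Nat.mod_lt _ h⟩ else 1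

/-- The braid relator `u v u (v u v)⁻¹`. -/
def braidRel {G : Type*} [Group G] (u v : G) : G := u * v * u * (v * u * v)⁻¹

/-- Artin-type relations on generators `1, …, n` determined by an edge predicate `E`:
generators joined by an edge braid, all other pairs of generators commute. -/
def relsOf (n : ℕ) (E : ℕ → ℕ → Prop) : Set (FreeGroup (Fin n)) :=
  { w | ∃ i j, 1 ≤ i ∧ i < j ∧ j ≤ n ∧
      ((E i j ∧ w = braidRel (gen n i) (gen n j)) ∨
       (¬ E i j ∧ w = ⁅gen n i, gen n j⁆)) }

/-- Edges of the `n`-cycle `Δ_n`: `{i, i+1}` for `1 ≤ i ≤ n-1`, and `{1, n}`. -/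
def cycEdge (n i j : ℕ) : Prop := (1 ≤ i ∧ i + 1 ≤ n ∧ j = i + 1) ∨ (i = 1 ∧ j = n)

/-- Defining relations of the Artin group `A(Δ_n)` of the `n`-cycle. -/
def cycleRels (n : ℕ) : Set (FreeGroup (Fin n)) := relsOf n (cycEdge n)

/-- Edges of the diagram `Δ_{t,n}`, where `r = n - 3 - t` and the generators are
`b_1, …, b_{4+r}` (vertices `1, …, 4+r`) and `c_{5+r}, …, c_n` (vertices `5+r, …, n`):
the braiding pairs are `{b_1,b_2}, {b_2,b_3}, {b_3,b_1}, {b_4,b_1}, {b_1,b_5}`,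
`{b_i,b_{i+1}}` for `5 ≤ i ≤ 3+r`, `{b_3,c_{5+r}}`, and `{c_i,c_{i+1}}` for
`5+r ≤ i ≤ n-1`. -/
def deltaEdge (n t i j : ℕ) : Prop :=
  (i = 1 ∧ j = 2) ∨ (i = 2 ∧ j = 3) ∨ (i = 1 ∧ j = 3) ∨ (i = 1 ∧ j = 4) ∨
  (i = 1 ∧ j = 5 ∧ 5 ≤ 4 + (n - 3 - t)) ∨
  (5 ≤ i ∧ i + 1 ≤ 4 + (n - 3 - t) ∧ j = i + 1) ∨
  (i = 3 ∧ j = 5 + (n - 3 - t) ∧ 5 + (n - 3 - t) ≤ n) ∨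
  (5 + (n - 3 - t) ≤ i ∧ i + 1 ≤ n ∧ j = i + 1)

/-- Defining relations of the Artin group `A(Δ_{t,n})`. -/
def deltaRels (n t : ℕ) : Set (FreeGroup (Fin n)) := relsOf n (deltaEdge n t)

/-- Edges of the Coxeter diagram `D_n`: `{1,3}, {2,3}`, and `{i, i+1}` for
`3 ≤ i ≤ n-1` (in particular `1` and `2` are not joined, so `x_1 x_2 = x_2 x_1`). -/
def dEdge (n i j : ℕ) : Prop :=
  (i = 1 ∧ j = 3) ∨ (i = 2 ∧ j = 3) ∨ (3 ≤ i ∧ i + 1 ≤ n ∧ j = i + 1)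

/-- Defining relations of the Artin group `A(D_n)` of type `D_n`. -/
def dRels (n : ℕ) : Set (FreeGroup (Fin n)) := relsOf n (dEdge n)

/-- The Artin group `A(D_n)` of type `D_n`. -/
abbrev ArtinD (n : ℕ) := PresentedGroup (dRels n)

/-- `G_{n,t}`: the quotient of `A(Δ_n)` by the normal closure of the `t`-twisted
cycle commutator `tc_t(a_1, …, a_n)`. -/
abbrev Gnt (n t : ℕ) := PresentedGroup (cycleRels n ∪ {tc (gen n) n t})

/-- `Q_{n,t}`: the quotient of `A(Δ_{t,n})` by the normal closure of the twisted
cycle commutator `tc(b_1, b_2, b_3, b_4)`. -/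
abbrev Qnt (n t : ℕ) := PresentedGroup (deltaRels n t ∪ {tc (gen n) 4 1})

/-- The `j`-th cyclic rotation of the sequence `y 1, …, y n`
(indices taken mod `n` in `{1, …, n}`, starting at `y j`). -/
def rot {G : Type*} [Group G] (y : ℕ → G) (n j : ℕ) : ℕ → G :=
  fun m => y ((j - 1 + (m - 1)) % n + 1)

theorem mulIcc_congr {M : Type*} [Monoid M] {x y : ℕ → M} {a b c d : ℕ}
    (hlen : b + 1 - a = d + 1 - c) (h : ∀ i, x (a + i) = y (c + i)) :
    mulIcc x a b = mulIcc y c d := by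
  simp only [mulIcc, hlen, h]

theorem mulIcc_eq_one {M : Type*} [Monoid M] (y : ℕ → M) {a b : ℕ} (h : b < a) :
    mulIcc y a b = 1 := by
  simp [mulIcc, Nat.sub_eq_zero_of_le (Nat.succ_le_of_lt h)]

theorem mulIcc_succ_right {M : Type*} [Monoid M] (y : ℕ → M) {a b : ℕ} (h : a ≤ b + 1) :
    mulIcc y a (b + 1) = mulIcc y a b * y (b + 1) := by
  have e : b + 1 + 1 - a = (b + 1 - a) + 1 := by omega
  simp [mulIcc, e, List.range_succ, Nat.add_sub_cancel' h]

theorem mulIcc_succ_left {M : Type*} [Monoid M] (y : ℕ → M) {a b : ℕ} (h : a ≤ b) :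
    mulIcc y a b = y a * mulIcc y (a + 1) b := by
  have e : b + 1 - a = (b + 1 - (a + 1)) + 1 := by omega
  simp only [mulIcc, e, List.range_succ_eq_map, List.map_cons, List.prod_cons, List.map_map]
  congr 3
  funext i
  simp only [Function.comp, Nat.succ_eq_add_one]
  congr 1
  omega

theorem commute_mulIcc {M : Type*} [Monoid M] {x : M} {y : ℕ → M} {a b : ℕ}
    (h : ∀ i, a ≤ i → i ≤ b → Commute x (y i)) : Commute x (mulIcc y a b) := by
  refine Commute.list_prod_right _ _ fun z hz => ?_
  obtain ⟨i, hi, rfl⟩ := List.mem_map.1 hz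
  have := List.mem_range.1 hi
  exact h _ (by omega) (by omega)

theorem BR.conj_eq {G : Type*} [Group G] {u v : G} (h : BR u v) :
    u * v * u⁻¹ = v⁻¹ * u * v := by
  rw [mul_inv_eq_iff_eq_mul, mul_assoc, mul_assoc, eq_inv_mul_iff_mul_eq, ← mul_assoc,
    ← mul_assoc]
  exact h.symm

/-- In a chain of consecutively braiding elements, conjugating the last one by the product of the
others agrees with conjugating the first one by the inverse of the product of the others. -/
theorem conj_mulIcc_eq {G : Type*} [Group G] (y : ℕ → G) {k : ℕ} (hk : 1 ≤ k)
    (d : ℕ) (hbr : ∀ i, k ≤ i → i < k + d → BR (y i) (y (i + 1)))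
    (hcm : ∀ i j, k ≤ i → i + 2 ≤ j → j ≤ k + d → Commute (y i) (y j)) :
    mulIcc y k (k + d - 1) * y (k + d) * (mulIcc y k (k + d - 1))⁻¹ =
      (mulIcc y (k + 1) (k + d))⁻¹ * y k * mulIcc y (k + 1) (k + d) := by
  induction d with
  | zero =>
    rw [mulIcc_eq_one y (show k + 0 < k + 1 by omega)]
    rw [mulIcc_eq_one y (by omega)]
    simp
  | succ d ih =>
    specialize ih (fun i h₁ h₂ => hbr i h₁ (by omega)) fun i j h₁ h₂ h₃ =>
      hcm i j h₁ h₂ (by omega)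
    have hU : mulIcc y k (k + d) = mulIcc y k (k + d - 1) * y (k + d) := by
      obtain ⟨e, he⟩ : ∃ e, k + d = e + 1 := ⟨k + d - 1, by omega⟩
      rw [he]
      exact mulIcc_succ_right y (by omega)
    have hc : Commute (y (k + d + 1)) (mulIcc y k (k + d - 1)) :=
      commute_mulIcc fun i h₁ h₂ => (hcm i (k + d + 1) h₁ (by omega) (by omega)).symm
    have hb := (hbr (k + d) (by omega) (by omega)).conj_eq
    rw [← add_assoc, Nat.add_sub_cancel, hU, mulIcc_succ_right y (show k + 1 ≤ k + d + 1 by omega)]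
    generalize mulIcc y k (k + d - 1) = U at *
    generalize mulIcc y (k + 1) (k + d) = V at *
    generalize y (k + d + 1) = w at *
    generalize y (k + d) = z at *
    calc U * z * w * (U * z)⁻¹ = U * (z * w * z⁻¹) * U⁻¹ := by group
      _ = (U * w⁻¹) * z * (w * U⁻¹) := by rw [hb]; group
      _ = (w⁻¹ * U) * z * (U⁻¹ * w) := by rw [hc.inv_left.eq, hc.inv_right.eq]
      _ = w⁻¹ * (U * z * U⁻¹) * w := by group
      _ = (V * w)⁻¹ * y k * (V * w) := by rw [ih]; group

theorem commutator_shift {G : Type*} [Group G] {a b m z P U V : G}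
    (hab : BR a b) (hza : BR z a) (haP : Commute a P) (haU : Commute a U) (hVb : Commute V b)
    (hVP : Commute V P) (hUV : U * z * U⁻¹ = V⁻¹ * m * V)
    (h : ⁅a, b⁻¹ * P * (U * z * U⁻¹) * (b⁻¹ * P)⁻¹⁆ = 1) :
    ⁅b, P * m⁻¹ * (V * a * V⁻¹) * (P * m⁻¹)⁻¹⁆ = 1 := by
  rw [commutatorElement_eq_one_iff_commute] at h ⊢
  have hz : a * z * a⁻¹ = z⁻¹ * a * z := BR.conj_eq hza.symm
  have key : a * (P * (U * z * U⁻¹) * P⁻¹) * a⁻¹ =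
      V⁻¹ * (P * m⁻¹ * (V * a * V⁻¹) * (P * m⁻¹)⁻¹) * V :=
    calc a * (P * (U * z * U⁻¹) * P⁻¹) * a⁻¹
        = (a * (P * U)) * z * ((P * U)⁻¹ * a⁻¹) := by group
      _ = P * U * (a * z * a⁻¹) * (P * U)⁻¹ := by
        rw [(haP.mul_right haU).eq, ((haP.mul_right haU).inv_inv).symm.eq]; group
      _ = P * (U * z⁻¹) * (a * U⁻¹) * (U * z * U⁻¹) * P⁻¹ := by rw [hz]; group
      _ = P * (U * z * U⁻¹)⁻¹ * a * (U * z * U⁻¹) * P⁻¹ := by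
        rw [haU.inv_right.eq]; group
      _ = (P * V⁻¹) * m⁻¹ * (V * a * V⁻¹) * m * (V * P⁻¹) := by rw [hUV]; group
      _ = V⁻¹ * (P * m⁻¹ * (V * a * V⁻¹) * (P * m⁻¹)⁻¹) * V := by
        rw [← hVP.inv_left.eq, hVP.inv_right.eq]; group
  have h₁ := (Commute.conj_iff (a * b)).2 h
  have e₁ : a * b * a * (a * b)⁻¹ = b := by
    rw [show a * b * a = b * a * b from hab]; group
  have e₂ : a * b * (b⁻¹ * P * (U * z * U⁻¹) * (b⁻¹ * P)⁻¹) * (a * b)⁻¹ =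
      a * (P * (U * z * U⁻¹) * P⁻¹) * a⁻¹ := by group
  rw [e₁, e₂, key] at h₁
  have h₂ := (Commute.conj_iff V).2 h₁
  rw [hVb.eq, mul_inv_cancel_right] at h₂
  convert h₂ using 1
  group

theorem tc_shift {G : Type*} [Group G] {n t : ℕ} (hn : 3 ≤ n) (ht1 : 1 ≤ t) (ht2 : t ≤ n - 2)
    {y y' : ℕ → G} (hy' : ∀ i, 1 ≤ i → y' i = y (i + 1)) (hper : y (n + 1) = y 1)
    (hbr : ∀ i, 1 ≤ i → BR (y i) (y (i + 1)))
    (hcm : ∀ i j, 1 ≤ i → i + 2 ≤ j → j + 2 ≤ i + n → Commute (y i) (y j))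
    (h : tc y n t = 1) : tc y' n t = 1 := by
  have hP : mulIcc (fun i => (y i)⁻¹) 2 (t + 1) =
      (y 2)⁻¹ * mulIcc (fun i => (y i)⁻¹) 3 (t + 1) := mulIcc_succ_left _ (by omega)
  have hP' : mulIcc (fun i => (y' i)⁻¹) 2 (t + 1) =
      mulIcc (fun i => (y i)⁻¹) 3 (t + 1) * (y (t + 2))⁻¹ := by
    rw [← mulIcc_succ_right (fun i => (y i)⁻¹) (show 3 ≤ t + 1 + 1 by omega)]
    refine mulIcc_congr (by omega) fun i => ?_
    rw [hy' _ (by omega), show 2 + i + 1 = 3 + i by omega]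
  have hV : mulIcc y' (t + 2) (n - 1) = mulIcc y (t + 3) n := by
    refine mulIcc_congr (by omega) fun i => ?_
    rw [hy' _ (by omega), show t + 2 + i + 1 = t + 3 + i by omega]
  rw [tc, hP] at h
  rw [tc, hP', hV, hy' 1 le_rfl, hy' n (by omega), hper]
  refine commutator_shift (hbr 1 le_rfl) (by simpa [hper] using hbr n (by omega)) ?_ ?_ ?_ ?_ ?_ h
  · exact commute_mulIcc fun i h₁ h₂ => (hcm 1 i le_rfl (by omega) (by omega)).inv_right
  · exact commute_mulIcc fun i h₁ h₂ => hcm 1 i le_rfl (by omega) (by omega)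
  · exact (commute_mulIcc fun i h₁ h₂ => hcm 2 i (by omega) (by omega) (by omega)).symm
  · refine commute_mulIcc fun j h₃ h₄ => Commute.inv_right (Commute.symm ?_)
    exact commute_mulIcc fun i h₁ h₂ => hcm j i (by omega) (by omega) (by omega)
  · have := conj_mulIcc_eq y (show 1 ≤ t + 2 by omega) (n - (t + 2)) (fun i h₁ h₂ => hbr i (by omega))
      fun i j h₁ h₂ h₃ => hcm i j (by omega) (by omega) (by omega)
    rwa [Nat.add_sub_cancel' (show t + 2 ≤ n by omega)] at this

theorem mod_add_eq_or {n x d : ℕ} (hd : d < n) :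
    (x + d) % n = x % n + d ∨ (x + d) % n + n = x % n + d := by
  have hx := Nat.mod_lt x (show 0 < n by omega)
  rw [Nat.add_mod, Nat.mod_eq_of_lt hd]
  rcases lt_or_ge (x % n + d) n with h | h
  · exact Or.inl (Nat.mod_eq_of_lt h)
  · right
    rw [Nat.mod_eq_sub_mod h, Nat.mod_eq_of_lt (by omega)]
    omega

/-- Lemma 2.5(i): if `a 1, …, a n` satisfy the defining relations
of `A(Δ_n)` and `1 ≤ t ≤ n-2`, then the `n` conditions `tc_t` of a cyclic rotation
of the sequence `= 1` are all equivalent. -/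
theorem tc_rotation_equiv {G : Type*} [Group G] (n t : ℕ) (hn : 3 ≤ n)
    (ht1 : 1 ≤ t) (ht2 : t ≤ n - 2) (a : ℕ → G)
    (hbr : ∀ i, 1 ≤ i → i + 1 ≤ n → BR (a i) (a (i + 1)))
    (hbr' : BR (a n) (a 1))
    (hcm : ∀ i j, 1 ≤ i → i < j → j ≤ n → j ≠ i + 1 → ¬(i = 1 ∧ j = n) →
      CM (a i) (a j)) :
    ∀ j j', 1 ≤ j → j ≤ n → 1 ≤ j' → j' ≤ n →
      (tc (rot a n j) n t = 1 ↔ tc (rot a n j') n t = 1) := by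
  have hbrc : ∀ x, BR (a (x % n + 1)) (a ((x + 1) % n + 1)) := fun x => by
    have hx := Nat.mod_lt x (show 0 < n by omega)
    have hx' := Nat.mod_lt (x + 1) (show 0 < n by omega)
    rcases mod_add_eq_or (x := x) (show 1 < n by omega) with h | h
    · rw [h]
      exact hbr _ (by omega) (by omega)
    · rw [show (x + 1) % n = 0 by omega, show x % n + 1 = n by omega]
      exact hbr'
  have hcmc : ∀ x d, 2 ≤ d → d + 2 ≤ n → Commute (a (x % n + 1)) (a ((x + d) % n + 1)) :=
      fun x d hd hd' => by
    have hx := Nat.mod_lt x (show 0 < n by omega)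
    have hx' := Nat.mod_lt (x + d) (show 0 < n by omega)
    rcases mod_add_eq_or (x := x) (show d < n by omega) with h | h
    · exact hcm _ _ (by omega) (by omega) (by omega) (by omega) (by omega)
    · exact Commute.symm (hcm _ _ (by omega) (by omega) (by omega) (by omega) (by omega))
  have step : ∀ j, 1 ≤ j → tc (rot a n j) n t = 1 → tc (rot a n (j + 1)) n t = 1 := fun j hj => by
    refine tc_shift hn ht1 ht2 (fun i hi => ?_) ?_ (fun i hi => ?_) fun i k hi hk hk' => ?_
    · simp only [rot]
      congr 3
      omega
    · simp [rot]
    · have := hbrc (j - 1 + (i - 1))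
      rwa [show j - 1 + (i - 1) + 1 = j - 1 + (i + 1 - 1) by omega] at this
    · have := hcmc (j - 1 + (i - 1)) (k - i) (by omega) (by omega)
      rwa [show j - 1 + (i - 1) + (k - i) = j - 1 + (k - 1) by omega] at this
  have steps : ∀ j d, 1 ≤ j → tc (rot a n j) n t = 1 → tc (rot a n (j + d)) n t = 1 := by
    intro j d hj h
    induction d with
    | zero => exact h
    | succ d ih => exact step (j + d) (by omega) ih
  have imp : ∀ j j', 1 ≤ j → j ≤ n → 1 ≤ j' → tc (rot a n j) n t = 1 →
      tc (rot a n j') n t = 1 := by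
    intro j j' hj hjn hj' h
    have hper : rot a n (j' + n) = rot a n j' := by
      funext m
      simp only [rot]
      rw [show j' + n - 1 + (m - 1) = j' - 1 + (m - 1) + n by omega, Nat.add_mod_right]
    have := steps j (j' + n - j) hj h
    rwa [show j + (j' + n - j) = j' + n by omega, hper] at this
  exact fun j j' hj hjn hj' hjn' => ⟨imp j j' hj hjn hj', imp j' j hj' hjn' hj⟩

end ArtinPaper
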